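/- arXiv:1502.03536 — 3 statements merged into one kernel-verified Lean document; each statement's English description precedes it below -/
import Mathlib

section
/- Let (Ω, ℙ) be a probability space, let ι be a nonempty finite index set, let ε ≥ 0 and let P, P̂ : ι → Ω → ℝ be such that for each i ∈ ι the maps ω ↦ P i ω and ω ↦ P̂ i ω are measurable and |P i ω − P̂ i ω| ≤ ε for all i ∈ ι and all ω ∈ Ω. Define the sample maxima m(ω) = max_{i ∈ ι} P i ω and m̂(ω) = max_{i ∈ ι} P̂ i ω, and the bias b = E[m − m̂]. Then for every real number k > 0, ℙ({ω : m(ω) − m̂(ω) − b > k·ε}) ≤ 1/k². -/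
open MeasureTheory

/-- Taking the maximum over a finite family is nonexpansive for the uniform distance. -/
lemma Finset.abs_sup'_sub_sup'_le {ι : Type*} {s : Finset ι} (hs : s.Nonempty) {f g : ι → ℝ}
    {ε : ℝ} (h : ∀ i ∈ s, |f i - g i| ≤ ε) : |s.sup' hs f - s.sup' hs g| ≤ ε := by
  have key : ∀ {f g : ι → ℝ}, (∀ i ∈ s, |f i - g i| ≤ ε) → s.sup' hs f ≤ s.sup' hs g + ε := by
    intro f g h
    refine Finset.sup'_le hs _ fun i hi => ?_
    linarith [(abs_le.mp (h i hi)).2, Finset.le_sup' g hi]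
  rw [abs_le]
  constructor
  · linarith [key fun i hi => abs_sub_comm (f i) (g i) ▸ h i hi]
  · linarith [key h]

/-- Chebyshev's inequality for a random variable bounded in absolute value. -/
lemma measure_mul_lt_sub_integral_le {Ω : Type*} [MeasurableSpace Ω] {μ : Measure Ω}
    [IsProbabilityMeasure μ] {X : Ω → ℝ} (hX : AEMeasurable X μ) {ε : ℝ}
    (h : ∀ ω, |X ω| ≤ ε) {k : ℝ} (hk : 0 < k) :
    μ {ω | k * ε < X ω - ∫ ω, X ω ∂μ} ≤ ENNReal.ofReal (1 / k ^ 2) := by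
  obtain ⟨ω₀⟩ := nonempty_of_isProbabilityMeasure μ
  rcases ((abs_nonneg _).trans (h ω₀)).eq_or_lt with rfl | hε
  · have hX0 : ∀ ω, X ω = 0 := fun ω => abs_nonpos_iff.mp (h ω)
    simp [hX0]
  have hIcc : ∀ᵐ ω ∂μ, X ω ∈ Set.Icc (-ε) ε := ae_of_all _ fun ω => abs_le.mp (h ω)
  have hvar : ProbabilityTheory.variance X μ ≤ ε ^ 2 := by
    have := ProbabilityTheory.variance_le_sq_of_bounded hIcc hX
    rwa [show (ε - -ε) / 2 = ε by ring] at this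
  calc μ {ω | k * ε < X ω - ∫ ω, X ω ∂μ}
      ≤ μ {ω | k * ε ≤ |X ω - ∫ ω, X ω ∂μ|} :=
        measure_mono fun ω (hω : _ < _) => hω.le.trans (le_abs_self (X ω - ∫ ω, X ω ∂μ))
    _ ≤ ENNReal.ofReal (ProbabilityTheory.variance X μ / (k * ε) ^ 2) :=
        ProbabilityTheory.meas_ge_le_variance_div_sq
          (memLp_of_bounded hIcc hX.aestronglyMeasurable 2) (mul_pos hk hε)
    _ ≤ ENNReal.ofReal (ε ^ 2 / (k * ε) ^ 2) := by gcongr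
    _ = ENNReal.ofReal (1 / k ^ 2) := by
        congr 1
        field_simp

/-- Paper Theorem 2: the maximum reconstructed statistic deviates from the
maximum observed statistic, after bias correction, by more than `k * ε` with
probability at most `1 / k ^ 2`. -/
theorem max_null_recovery_chebyshev
    {Ω : Type*} [MeasureSpace Ω] (ℙ : Measure Ω := by volume_tac)
    [IsProbabilityMeasure ℙ]
    {ι : Type*} [Fintype ι] [Nonempty ι]
    (ε : ℝ) (hε : 0 ≤ ε)
    (P Phat : ι → Ω → ℝ)
    (hPmeas : ∀ i, Measurable (P i)) (hPhatmeas : ∀ i, Measurable (Phat i))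
    (herr : ∀ i ω, |P i ω - Phat i ω| ≤ ε)
    (m mhat : Ω → ℝ)
    (hm : ∀ ω, m ω = Finset.univ.sup' Finset.univ_nonempty (fun i => P i ω))
    (hmhat : ∀ ω, mhat ω = Finset.univ.sup' Finset.univ_nonempty (fun i => Phat i ω))
    (b : ℝ) (hb : b = ∫ ω, (m ω - mhat ω) ∂ℙ)
    (k : ℝ) (hk : 0 < k) :
    ℙ {ω | m ω - mhat ω - b > k * ε} ≤ ENNReal.ofReal (1 / k ^ 2) := by
  have hsup : ∀ f : ι → Ω → ℝ, (∀ i, Measurable (f i)) →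
      Measurable fun ω => Finset.univ.sup' Finset.univ_nonempty fun i => f i ω := by
    intro f hf
    simpa only [← Finset.sup'_apply] using
      Finset.measurable_sup' Finset.univ_nonempty fun i _ => hf i
  have hmeas : Measurable fun ω => m ω - mhat ω := by
    simp only [hm, hmhat]
    exact (hsup P hPmeas).sub (hsup Phat hPhatmeas)
  subst hb
  refine measure_mul_lt_sub_integral_le hmeas.aemeasurable (fun ω => ?_) hk
  rw [hm, hmhat]
  exact Finset.abs_sup'_sub_sup'_le _ fun i _ => herr i ω
end

section
/- Let σ > 0, t > 0 and 0 < γ < 1, and define the density f(a) = (1/(2π·γ·σ⁴·t²))·√(4γσ⁴t² − (a − σ²t)²) for a in the interval [σ²t(1 − 2√γ), σ²t(1 + 2√γ)], and f(a) = 0 otherwise. Let γ₋ = σ²t(1 − 2√γ) denote the left edge of the support. Then ∫_{σ²t(1−2√γ)}^{σ²t(1+2√γ)} f(a)/(γ₋ − a) da = −1/(σ²t·√γ). -/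
open Real

theorem hasDerivAt_arcsin_add_sqrt_one_sub_sq {x : ℝ} (hx : x ∈ Set.Ioo (-1 : ℝ) 1) :
    HasDerivAt (fun y => arcsin y + √(1 - y ^ 2)) (√(1 - x ^ 2) / (1 + x)) x := by
  obtain ⟨h₁, h₂⟩ := hx
  have hpos : 0 < 1 - x ^ 2 := by nlinarith
  have hsq : √(1 - x ^ 2) ^ 2 = 1 - x ^ 2 := sq_sqrt hpos.le
  have hs : √(1 - x ^ 2) ≠ 0 := (sqrt_pos.2 hpos).ne'
  have hx' : 1 + x ≠ 0 := by linarith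
  have hpoly : HasDerivAt (fun y : ℝ => 1 - y ^ 2) (-(2 * x)) x := by
    simpa using (hasDerivAt_pow 2 x).const_sub 1
  refine ((hasDerivAt_arcsin h₁.ne' h₂.ne).add (hpoly.sqrt hpos.ne')).congr_deriv ?_
  field_simp
  rw [hsq]
  ring

theorem integral_sqrt_one_sub_sq_div_one_add :
    ∫ x in (-1 : ℝ)..1, √(1 - x ^ 2) / (1 + x) = π := by
  have hcont : ContinuousOn (fun y => arcsin y + √(1 - y ^ 2)) (Set.Icc (-1) 1) :=
    (continuous_arcsin.add (by fun_prop)).continuousOn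
  have hint := intervalIntegral.integrableOn_deriv_of_nonneg hcont
    (fun x hx => hasDerivAt_arcsin_add_sqrt_one_sub_sq hx)
    (fun x hx => div_nonneg (sqrt_nonneg _) (by linarith [hx.1]))
  rw [intervalIntegral.integral_eq_sub_of_hasDerivAt_of_le (by norm_num) hcont
    (fun x hx => hasDerivAt_arcsin_add_sqrt_one_sub_sq hx)
    ((intervalIntegrable_iff_integrableOn_Ioc_of_le (by norm_num)).2 hint)]
  norm_num

theorem integral_sqrt_sq_sub_sq_div_left_edge_sub (m : ℝ) {R : ℝ} (hR : 0 < R) :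
    ∫ a in (m - R)..(m + R), √(R ^ 2 - (a - m) ^ 2) / (m - R - a) = -(R * π) := by
  have hsub := intervalIntegral.smul_integral_comp_add_mul (a := -1) (b := 1)
    (fun a => √(R ^ 2 - (a - m) ^ 2) / (m - R - a)) R m
  have hscale : ∀ x : ℝ, √(R ^ 2 - (m + R * x - m) ^ 2) / (m - R - (m + R * x)) =
      -(√(1 - x ^ 2) / (1 + x)) := fun x => by
    rw [show R ^ 2 - (m + R * x - m) ^ 2 = R ^ 2 * (1 - x ^ 2) by ring,
      sqrt_mul (sq_nonneg R), sqrt_sq hR.le,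
      show m - R - (m + R * x) = R * -(1 + x) by ring, mul_div_mul_left _ _ hR.ne', div_neg]
  simp only [hscale, intervalIntegral.integral_neg, integral_sqrt_one_sub_sq_div_one_add,
    smul_eq_mul, mul_neg, mul_one] at hsub
  rw [hsub, sub_eq_add_neg]

/-- Evaluation of the Cauchy transform of the limiting spectral measure at the
left edge `γ₋ = σ²t(1 - 2√γ)` of its support: `G_μ(γ₋) = -1/(σ²t√γ)`. -/
theorem mp_cauchy_transform_left_edge
    (σ t γ : ℝ) (hσ : 0 < σ) (ht : 0 < t) (hγ : 0 < γ) (hγ1 : γ < 1)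
    (f : ℝ → ℝ)
    (hf : ∀ a, f a =
      if a ∈ Set.Icc (σ ^ 2 * t * (1 - 2 * Real.sqrt γ))
          (σ ^ 2 * t * (1 + 2 * Real.sqrt γ)) then
        (1 / (2 * Real.pi * γ * σ ^ 4 * t ^ 2)) *
          Real.sqrt (4 * γ * σ ^ 4 * t ^ 2 - (a - σ ^ 2 * t) ^ 2)
      else 0) :
    ∫ a in (σ ^ 2 * t * (1 - 2 * Real.sqrt γ))..(σ ^ 2 * t * (1 + 2 * Real.sqrt γ)),
      f a / (σ ^ 2 * t * (1 - 2 * Real.sqrt γ) - a) =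
      -(1 / (σ ^ 2 * t * Real.sqrt γ)) := by
  have hm : 0 < σ ^ 2 * t := by positivity
  have hs : 0 < √γ := sqrt_pos.2 hγ
  have hsq : √γ ^ 2 = γ := sq_sqrt hγ.le
  have hR : 0 < 2 * (σ ^ 2 * t) * √γ := by positivity
  have hl : σ ^ 2 * t * (1 - 2 * √γ) = σ ^ 2 * t - 2 * (σ ^ 2 * t) * √γ := by ring
  have hr : σ ^ 2 * t * (1 + 2 * √γ) = σ ^ 2 * t + 2 * (σ ^ 2 * t) * √γ := by ring
  have hR2 : 4 * γ * σ ^ 4 * t ^ 2 = (2 * (σ ^ 2 * t) * √γ) ^ 2 := by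
    linear_combination (-4 * σ ^ 4 * t ^ 2) * hsq
  simp only [hl, hr, hR2] at hf
  rw [hl, hr]
  have hle : σ ^ 2 * t - 2 * (σ ^ 2 * t) * √γ ≤ σ ^ 2 * t + 2 * (σ ^ 2 * t) * √γ := by linarith
  rw [intervalIntegral.integral_congr (g := fun a => 1 / (2 * π * γ * σ ^ 4 * t ^ 2) *
    (√((2 * (σ ^ 2 * t) * √γ) ^ 2 - (a - σ ^ 2 * t) ^ 2) /
      (σ ^ 2 * t - 2 * (σ ^ 2 * t) * √γ - a)))
    (fun a ha => by
      rw [Set.uIcc_of_le hle] at ha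
      simp only [hf a, if_pos ha, mul_div_assoc]),
    intervalIntegral.integral_const_mul, integral_sqrt_sq_sub_sq_div_left_edge_sub _ hR]
  have hπ := pi_ne_zero
  field_simp
  linear_combination -hsq
end

section
/- Let σ > 0, t > 0 and 0 < γ < 1, and define the density f(a) = (1/(2π·γ·σ⁴·t²))·√(4γσ⁴t² − (a − σ²t)²) for a in the interval [σ²t(1 − 2√γ), σ²t(1 + 2√γ)], and f(a) = 0 otherwise. Then for every real θ with 0 < θ < 1/(σ²t·√γ), setting z = σ²t + 1/θ + γσ⁴t²·θ, one has z > σ²t(1 + 2√γ) and ∫_{σ²t(1−2√γ)}^{σ²t(1+2√γ)} f(a)/(z − a) da = θ. -/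
open Real

/-- The derivative of `arcsin ((w x - R²) / (R (w - x)))` inside the disc of radius `R`, where
`D = √(w² - R²)`. -/
theorem hasDerivAt_arcsin_moebius {R w D x : ℝ} (hR : 0 < R) (hw : R < w) (hD : 0 < D)
    (hDw : D ^ 2 = w ^ 2 - R ^ 2) (hx : x ∈ Set.Ioo (-R) R) :
    HasDerivAt (fun y => arcsin ((w * y - R ^ 2) / (R * (w - y))))
      (D / ((w - x) * √(R ^ 2 - x ^ 2))) x := by
  obtain ⟨hx1, hx2⟩ := hx
  have hwx : 0 < w - x := by linarith
  have hden : 0 < R * (w - x) := mul_pos hR hwx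
  have hpos : 0 < R ^ 2 - x ^ 2 := by nlinarith
  have hs : 0 < √(R ^ 2 - x ^ 2) := sqrt_pos.2 hpos
  set u := (w * x - R ^ 2) / (R * (w - x)) with hu
  have hcompl : 1 - u ^ 2 = (D * √(R ^ 2 - x ^ 2) / (R * (w - x))) ^ 2 := by
    rw [hu, div_pow, div_pow, mul_pow D, sq_sqrt hpos.le, hDw]
    field_simp
    ring
  have hlt : 0 < 1 - u ^ 2 := by rw [hcompl]; positivity
  have hsqrt : √(1 - u ^ 2) = D * √(R ^ 2 - x ^ 2) / (R * (w - x)) := by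
    rw [hcompl, sqrt_sq (by positivity)]
  have hderiv : HasDerivAt (fun y => (w * y - R ^ 2) / (R * (w - y)))
      (D ^ 2 / (R * (w - x) ^ 2)) x := by
    have hnum : HasDerivAt (fun y => w * y - R ^ 2) (w * 1) x :=
      ((hasDerivAt_id x).const_mul w).sub_const _
    have hdenom : HasDerivAt (fun y => R * (w - y)) (R * -1) x :=
      ((hasDerivAt_id x).const_sub w).const_mul R
    refine (hnum.div hdenom hden.ne').congr_deriv ?_
    rw [hDw]
    field_simp
    ring
  have hmain := (hasDerivAt_arcsin (by nlinarith : u ≠ -1) (by nlinarith : u ≠ 1)).comp x hderiv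
  refine hmain.congr_deriv ?_
  rw [hsqrt]
  field_simp

/-- The unnormalised Cauchy transform of the semicircle of radius `R`, to the right of the
support. -/
theorem integral_sqrt_sq_sub_sq_div_sub {R w D : ℝ} (hR : 0 < R) (hw : R < w) (hD : 0 < D)
    (hDw : D ^ 2 = w ^ 2 - R ^ 2) :
    ∫ x in (-R)..R, √(R ^ 2 - x ^ 2) / (w - x) = π * (w - D) := by
  have hne : ∀ x ∈ Set.Icc (-R) R, w - x ≠ 0 := fun x hx => by linarith [hx.2]
  have hint : IntervalIntegrable (fun x => √(R ^ 2 - x ^ 2) / (w - x)) MeasureTheory.volume (-R) R := by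
    refine ContinuousOn.intervalIntegrable_of_Icc (by linarith) ?_
    exact ContinuousOn.div (by fun_prop) (by fun_prop) hne
  have hcont : ContinuousOn (fun y => w * arcsin (y / R) - √(R ^ 2 - y ^ 2)
      - D * arcsin ((w * y - R ^ 2) / (R * (w - y)))) (Set.Icc (-R) R) := by
    have hu : ContinuousOn (fun y => (w * y - R ^ 2) / (R * (w - y))) (Set.Icc (-R) R) :=
      ContinuousOn.div (by fun_prop) (by fun_prop) fun x hx => mul_ne_zero hR.ne' (hne x hx)
    have hv : Continuous (fun y => w * arcsin (y / R) - √(R ^ 2 - y ^ 2)) :=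
      ((continuous_arcsin.comp (continuous_id.div_const R)).const_mul w).sub (by fun_prop)
    exact hv.continuousOn.sub
      (continuousOn_const.mul (continuous_arcsin.comp_continuousOn hu))
  rw [intervalIntegral.integral_eq_sub_of_hasDerivAt_of_le (by linarith) hcont ?_ hint]
  · have h1 : (w * R - R ^ 2) / (R * (w - R)) = 1 := by
      rw [div_eq_one_iff_eq (mul_ne_zero hR.ne' (by linarith))]
      ring
    have h2 : (w * -R - R ^ 2) / (R * (w - -R)) = -1 := by
      rw [div_eq_iff (mul_ne_zero hR.ne' (by linarith))]
      ring
    simp only [h1, h2, neg_div, div_self hR.ne', arcsin_neg, arcsin_one, neg_sq, sub_self,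
      sqrt_zero]
    ring
  · intro x hx
    have hwx : 0 < w - x := by linarith [hx.2]
    have hpos : 0 < R ^ 2 - x ^ 2 := by nlinarith [hx.1, hx.2]
    have hs : 0 < √(R ^ 2 - x ^ 2) := sqrt_pos.2 hpos
    have hss : √(R ^ 2 - x ^ 2) ^ 2 = R ^ 2 - x ^ 2 := sq_sqrt hpos.le
    have hsqrt : HasDerivAt (fun y => √(R ^ 2 - y ^ 2))
        (-(2 * x) / (2 * √(R ^ 2 - x ^ 2))) x := by
      refine HasDerivAt.sqrt ?_ hpos.ne'
      simpa using (hasDerivAt_pow 2 x).const_sub (R ^ 2)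
    have harcsin : HasDerivAt (fun y => arcsin (y / R)) (1 / √(R ^ 2 - x ^ 2)) x := by
      have hcompl : √(1 - (x / R) ^ 2) = √(R ^ 2 - x ^ 2) / R := by
        rw [show 1 - (x / R) ^ 2 = (R ^ 2 - x ^ 2) / R ^ 2 by field_simp, sqrt_div hpos.le,
          sqrt_sq hR.le]
      have h1 : x / R ≠ -1 := by
        rw [Ne, div_eq_iff hR.ne']
        linarith [hx.1]
      have h2 : x / R ≠ 1 := by
        rw [Ne, div_eq_iff hR.ne']
        linarith [hx.2]
      refine ((hasDerivAt_arcsin h1 h2).comp x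
        ((hasDerivAt_id x).div_const R)).congr_deriv ?_
      rw [hcompl]
      field_simp
    refine (((harcsin.const_mul w).sub hsqrt).sub
      ((hasDerivAt_arcsin_moebius hR hw hD hDw hx).const_mul D)).congr_deriv ?_
    field_simp
    rw [hss]
    linear_combination -hDw

/-- The functional inverse `G_μ⁻¹(θ) = σ²t + 1/θ + γσ⁴t²θ` of the Cauchy
transform of the limiting spectral measure: for `0 < θ < 1/(σ²t√γ)` the point
`z = σ²t + 1/θ + γσ⁴t²θ` lies to the right of the support and `G_μ(z) = θ`. -/
theorem mp_cauchy_transform_inverse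
    (σ t γ : ℝ) (hσ : 0 < σ) (ht : 0 < t) (hγ : 0 < γ) (hγ1 : γ < 1)
    (f : ℝ → ℝ)
    (hf : ∀ a, f a =
      if a ∈ Set.Icc (σ ^ 2 * t * (1 - 2 * Real.sqrt γ))
          (σ ^ 2 * t * (1 + 2 * Real.sqrt γ)) then
        (1 / (2 * Real.pi * γ * σ ^ 4 * t ^ 2)) *
          Real.sqrt (4 * γ * σ ^ 4 * t ^ 2 - (a - σ ^ 2 * t) ^ 2)
      else 0)
    (θ : ℝ) (hθ : 0 < θ) (hθ' : θ < 1 / (σ ^ 2 * t * Real.sqrt γ))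
    (z : ℝ) (hz : z = σ ^ 2 * t + 1 / θ + γ * σ ^ 4 * t ^ 2 * θ) :
    z > σ ^ 2 * t * (1 + 2 * Real.sqrt γ) ∧
      ∫ a in (σ ^ 2 * t * (1 - 2 * Real.sqrt γ))..(σ ^ 2 * t * (1 + 2 * Real.sqrt γ)),
        f a / (z - a) = θ := by
  set m := σ ^ 2 * t with hm
  set r := m * √γ with hr
  have hm0 : 0 < m := by positivity
  have hr0 : 0 < r := by positivity
  have hr2 : γ * σ ^ 4 * t ^ 2 = r ^ 2 := by
    rw [hr, mul_pow, sq_sqrt hγ.le, hm]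
    ring
  have hrθ : r * θ < 1 := by rwa [lt_div_iff₀ hr0, mul_comm] at hθ'
  set w := 1 / θ + r ^ 2 * θ with hw
  have hzw : z = m + w := by rw [hz, hr2, hw]; ring
  have hwr : 2 * r < w := by
    have h : w - 2 * r = (1 - r * θ) ^ 2 / θ := by
      rw [hw]
      field_simp
      ring
    have : 0 < (1 - r * θ) ^ 2 / θ := div_pos (pow_pos (by linarith) 2) hθ
    linarith
  have hleft : m * (1 - 2 * √γ) = m - 2 * r := by rw [hr]; ring
  have hright : m * (1 + 2 * √γ) = m + 2 * r := by rw [hr]; ring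
  have hD : 0 < 1 / θ - r ^ 2 * θ := by
    have h : 1 / θ - r ^ 2 * θ = (1 - r * θ) * (1 + r * θ) / θ := by
      field_simp
      ring
    rw [h]
    exact div_pos (mul_pos (by linarith) (by positivity)) hθ
  have hDw : (1 / θ - r ^ 2 * θ) ^ 2 = w ^ 2 - (2 * r) ^ 2 := by
    rw [hw]
    field_simp
    ring
  refine ⟨by rw [hright, hzw]; linarith, ?_⟩
  rw [hleft, hright] at hf ⊢
  have hcongr : Set.EqOn (fun a => f a / (z - a))
      (fun a => 1 / (2 * π * r ^ 2) * (√((2 * r) ^ 2 - (a - m) ^ 2) / (w - (a - m))))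
      (Set.uIcc (m - 2 * r) (m + 2 * r)) := by
    intro a ha
    rw [Set.uIcc_of_le (by linarith)] at ha
    have hden : z - a = w - (a - m) := by rw [hzw]; ring
    have hc : 2 * π * γ * σ ^ 4 * t ^ 2 = 2 * π * r ^ 2 := by rw [← hr2]; ring
    have hrad : 4 * γ * σ ^ 4 * t ^ 2 = (2 * r) ^ 2 := by rw [mul_pow, ← hr2]; ring
    simp only [hf, if_pos ha, hden, hc, hrad]
    ring
  rw [intervalIntegral.integral_congr hcongr, intervalIntegral.integral_const_mul,
    intervalIntegral.integral_comp_sub_right (fun x => √((2 * r) ^ 2 - x ^ 2) / (w - x)) m,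
    show m - 2 * r - m = -(2 * r) by ring, show m + 2 * r - m = 2 * r by ring,
    integral_sqrt_sq_sub_sq_div_sub (by positivity) hwr hD hDw, hw]
  field_simp
  ring
end
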